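/- arXiv:1410.5654 — 2 statements merged into one kernel-verified Lean document; each statement's English description precedes it below -/
import Mathlib

section
/- Let K be an algebraically closed field of characteristic 0, let n ≥ 3, k ≥ 1, l ≥ 2, s ≥ 2. Let t : ℕ → ℕ be given by t(i) = i+1 for 0 ≤ i ≤ n−1, t(j) = 3 for n ≤ j ≤ n+k, t(j) = 2 for n+k+1 ≤ j ≤ n+k+l, t(j) = 1 for n+k+l+1 ≤ j ≤ n+k+l+s, and t(j) = 0 for j > n+k+l+s. Then there exist finitely many homogeneous ideals J_1, …, J_m of K[x,y] such that every homogeneous ideal I of K[x,y] with t_I = t satisfies φ(I) = J_i for some linear change of variables φ and some i. -/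
open MvPolynomial

noncomputable section

/-- The polynomial ring `K[x,y]`. -/
abbrev Pxy (K : Type*) [Field K] := MvPolynomial (Fin 2) K

/-- An ideal of `K[x,y]` is homogeneous if it contains all homogeneous
components of each of its elements. -/
def IsHomog {K : Type*} [Field K] (I : Ideal (Pxy K)) : Prop :=
  ∀ f ∈ I, ∀ k : ℕ, homogeneousComponent k f ∈ I

/-- The Hilbert function of an ideal:
`t_I(k) = dim_K (K[x,y]_k / (I ∩ K[x,y]_k))`. -/
def hilb (K : Type*) [Field K] (I : Ideal (Pxy K)) (k : ℕ) : ℕ :=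
  Module.finrank K
    (homogeneousSubmodule (Fin 2) K k ⧸
      Submodule.comap (homogeneousSubmodule (Fin 2) K k).subtype (I.restrictScalars K))

/-- A linear change of variables: a `K`-algebra automorphism sending the
variables to homogeneous polynomials of degree 1. -/
def IsLinChange {K : Type*} [Field K] (φ : Pxy K ≃ₐ[K] Pxy K) : Prop :=
  ∀ i : Fin 2, (φ (X i)).IsHomogeneous 1

/-- `t` is of homogeneous finite type: there are finitely many homogeneous ideals
`J₁, …, Jₘ` such that every homogeneous ideal `I` with Hilbert function `t` is
mapped onto some `Jᵢ` by a linear change of variables. -/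
def HomogFiniteType (K : Type*) [Field K] (t : ℕ → ℕ) : Prop :=
  ∃ S : Set (Ideal (Pxy K)), S.Finite ∧ (∀ J ∈ S, IsHomog J) ∧
    ∀ I : Ideal (Pxy K), IsHomog I → (∀ k, hilb K I k = t k) →
      ∃ φ : Pxy K ≃ₐ[K] Pxy K, IsLinChange φ ∧ Ideal.map φ I ∈ S

section
variable {K : Type*} [Field K]

attribute [local instance] MvPolynomial.gradedAlgebra in
theorem homogeneousComponent_add_mul {σ : Type*} {f : MvPolynomial σ K} {m : ℕ}
    (hf : f.IsHomogeneous m) (n : ℕ) (q : MvPolynomial σ K) :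
    homogeneousComponent (m + n) (f * q) = f * homogeneousComponent n q := by
  have h := DirectSum.coe_decompose_mul_add_of_left_mem (homogeneousSubmodule σ K)
    (i := m) (j := n) (a := f) (b := q) hf
  have e (p : MvPolynomial σ K) (i : ℕ) :
      (DirectSum.decompose (homogeneousSubmodule σ K) p i : MvPolynomial σ K) =
        homogeneousComponent i p := decomposition.decompose'_apply p i
  rwa [e, e] at h

theorem isHomogeneous_of_mul {σ : Type*} {f q : MvPolynomial σ K} {m n : ℕ} (hf0 : f ≠ 0)
    (hf : f.IsHomogeneous m) (h : (f * q).IsHomogeneous (m + n)) : q.IsHomogeneous n := by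
  have h1 := homogeneousComponent_add_mul hf n q
  rw [homogeneousComponent_eq_self h] at h1
  rw [mul_left_cancel₀ hf0 h1]
  exact homogeneousComponent_isHomogeneous n q

theorem finrank_homogeneousSubmodule_fin_two (d : ℕ) :
    Module.finrank K (homogeneousSubmodule (Fin 2) K d) = d + 1 := by
  let e : Fin (d + 1) → (Fin 2 →₀ ℕ) := fun i =>
    Finsupp.single 0 (i : ℕ) + Finsupp.single 1 (d - i)
  have he : Function.Injective e := fun i j hij => by
    have := DFunLike.congr_fun hij 0
    simp [e] at this
    exact Fin.ext this
  have hr : Set.range e = {m | m.degree = d} := by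
    ext m
    simp only [Set.mem_range, Set.mem_ofPred_eq, Finsupp.degree_eq_sum, Fin.sum_univ_two]
    constructor
    · rintro ⟨i, rfl⟩
      simp [e]
      omega
    · intro h
      refine ⟨⟨m 0, by omega⟩, ?_⟩
      ext i
      fin_cases i <;> simp [e]
      omega
  have hspan : homogeneousSubmodule (Fin 2) K d =
      Submodule.span K (Set.range fun i => (monomial (e i) 1 : Pxy K)) := by
    rw [homogeneousSubmodule_eq_finsupp_supported, AddMonoidAlgebra.supported_eq_span_single, ← hr,
      ← Set.range_comp]
    rfl
  have hli : LinearIndependent K fun i => (monomial (e i) 1 : Pxy K) := by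
    have := (basisMonomials (Fin 2) K).linearIndependent.comp e he
    simpa [Function.comp_def] using this
  rw [hspan, finrank_span_eq_card hli, Fintype.card_fin]

instance finite_homogeneousSubmodule_fin_two (d : ℕ) :
    Module.Finite K (homogeneousSubmodule (Fin 2) K d) :=
  Module.Finite.iff_fg.mpr (homogeneousSubmodule_fg (Fin 2) K d)

theorem exists_eq_of_isHomogeneous_one {p : Pxy K} (hp : p.IsHomogeneous 1) :
    ∃ a b : K, p = C a * X 0 + C b * X 1 := by
  rw [← mem_homogeneousSubmodule, homogeneousSubmodule_one_eq_span_X] at hp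
  obtain ⟨c, rfl⟩ := (Submodule.mem_span_range_iff_exists_fun K).mp hp
  exact ⟨c 0, c 1, by simp [Fin.sum_univ_two, smul_eq_C_mul]⟩

theorem homogeneousSubmodule_succ_le (v : ℕ) :
    homogeneousSubmodule (Fin 2) K (v + 1) ≤
      (homogeneousSubmodule (Fin 2) K v).map (LinearMap.mulLeft K (X 0)) ⊔
      (homogeneousSubmodule (Fin 2) K v).map (LinearMap.mulLeft K (X 1)) := by
  rw [← homogeneousSubmodule_one_pow, pow_succ, homogeneousSubmodule_one_pow,
    Submodule.mul_le]
  intro m hm n hn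
  obtain ⟨a, b, rfl⟩ := exists_eq_of_isHomogeneous_one hn
  refine Submodule.mem_sup.mpr ⟨X 0 * (a • m), ⟨_, Submodule.smul_mem _ a hm, rfl⟩,
    X 1 * (b • m), ⟨_, Submodule.smul_mem _ b hm, rfl⟩, ?_⟩
  simp only [smul_eq_C_mul]
  ring

theorem finrank_map_mulLeft {g : Pxy K} (hg : g ≠ 0) (V : Submodule K (Pxy K)) :
    Module.finrank K (V.map (LinearMap.mulLeft K g)) = Module.finrank K V :=
  (Submodule.equivMapOfInjective _ (mul_right_injective₀ hg) V).symm.finrank_eq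

theorem exists_submodule_le_finrank_eq {M : Type*} [AddCommGroup M] [Module K M]
    (T : Submodule K M) {n : ℕ} (hn : n ≤ Module.finrank K T) :
    ∃ T' ≤ T, Module.finrank K T' = n := by
  obtain ⟨f, hf⟩ := exists_linearIndependent_of_le_finrank hn
  refine ⟨Submodule.span K (Set.range fun i => (f i : M)), ?_, ?_⟩
  · rw [Submodule.span_le]
    rintro _ ⟨i, rfl⟩
    exact (f i).2
  · rw [finrank_span_eq_card, Fintype.card_fin]
    exact hf.map' T.subtype T.ker_subtype

/-- A space of binary forms whose product with the linear forms grows as slowly as possible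
consists of all multiples of its greatest common divisor. -/
theorem exists_eq_map_mulLeft_homogeneousSubmodule (v : ℕ) (V W : Submodule K (Pxy K))
    [Module.Finite K W] (hV : Module.finrank K V = v + 1) (hW : Module.finrank K W ≤ v + 2)
    (h0 : V.map (LinearMap.mulLeft K (X 0)) ≤ W) (h1 : V.map (LinearMap.mulLeft K (X 1)) ≤ W) :
    ∃ g : Pxy K, g ≠ 0 ∧ V = (homogeneousSubmodule (Fin 2) K v).map (LinearMap.mulLeft K g) := by
  have hX (i : Fin 2) : (X i : Pxy K) ≠ 0 := X_ne_zero i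
  induction v generalizing V W with
  | zero =>
    have : Module.Finite K V := Module.finite_of_finrank_pos (by omega)
    obtain ⟨g, hgV, hg⟩ := V.exists_mem_ne_zero_of_ne_bot (by rintro rfl; simp at hV)
    refine ⟨g, hg, (Submodule.eq_of_le_of_finrank_eq ?_ ?_).symm⟩
    · rintro _ ⟨p, hp, rfl⟩
      obtain ⟨c, rfl⟩ : ∃ c, C c = p :=
        ⟨coeff 0 p, (totalDegree_eq_zero_iff_eq_C.mp
          ((totalDegree_zero_iff_isHomogeneous _).mpr hp)).symm⟩
      rw [LinearMap.mulLeft_apply, mul_comm, ← smul_eq_C_mul]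
      exact V.smul_mem c hgV
    · rw [finrank_map_mulLeft hg, finrank_homogeneousSubmodule_fin_two, hV]
  | succ v ih =>
    have : Module.Finite K V := Module.finite_of_finrank_pos (by omega)
    have hsup := Submodule.finrank_sup_add_finrank_inf_eq (V.map (LinearMap.mulLeft K (X 0)))
      (V.map (LinearMap.mulLeft K (X 1)))
    rw [finrank_map_mulLeft (hX 0), finrank_map_mulLeft (hX 1)] at hsup
    have hle : Module.finrank K ↥(V.map (LinearMap.mulLeft K (X 0)) ⊔
        V.map (LinearMap.mulLeft K (X 1))) ≤ Module.finrank K W :=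
      Submodule.finrank_mono (sup_le h0 h1)
    obtain ⟨T, hT, hTr⟩ := exists_submodule_le_finrank_eq (V.map (LinearMap.mulLeft K (X 0)) ⊓
      V.map (LinearMap.mulLeft K (X 1))) (n := v + 1) (by omega)
    set U := T.comap (LinearMap.mulLeft K (X 0 * X 1)) with hU
    have hmap : U.map (LinearMap.mulLeft K (X 0 * X 1)) = T := by
      rw [hU, Submodule.map_comap_eq_self]
      intro t ht
      obtain ⟨⟨a, -, rfl⟩, ⟨b, -, hab⟩⟩ := hT ht
      simp only [LinearMap.mulLeft_apply] at hab
      have hd : (X 1 : Pxy K) ∣ a := by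
        have : (X 1 : Pxy K) ∣ X 0 * a := ⟨b, hab.symm⟩
        rcases X_dvd_mul_iff.mp this with h | h
        · simp [X_dvd_X] at h
        · exact h
      obtain ⟨u, rfl⟩ := hd
      exact ⟨u, by simp⟩
    have hUr : Module.finrank K U = v + 1 := by
      rw [← finrank_map_mulLeft (mul_ne_zero (hX 0) (hX 1)), hmap, hTr]
    have hcancel (i j : Fin 2) (u a : Pxy K) (ha : a ∈ V) (h : X i * a = X i * (X j * u)) :
        X j * u ∈ V := by
      rwa [← mul_left_cancel₀ (hX i) h]
    obtain ⟨g, hg, hUg⟩ := ih U V hUr (by omega)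
      (by
        rintro _ ⟨u, hu, rfl⟩
        obtain ⟨-, ⟨b, hb, hbu⟩⟩ := hT hu
        exact hcancel 1 0 u b hb (hbu.trans (by simp only [LinearMap.mulLeft_apply]; ring)))
      (by
        rintro _ ⟨u, hu, rfl⟩
        obtain ⟨⟨b, hb, hbu⟩, -⟩ := hT hu
        exact hcancel 0 1 u b hb (hbu.trans (by simp only [LinearMap.mulLeft_apply]; ring)))
    refine ⟨g, hg, (Submodule.eq_of_le_of_finrank_eq ?_ ?_).symm⟩
    · rintro _ ⟨p, hp, rfl⟩
      obtain ⟨_, ⟨a, ha, rfl⟩, _, ⟨b, hb, rfl⟩, rfl⟩ :=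
        Submodule.mem_sup.mp (homogeneousSubmodule_succ_le v hp)
      have hgU (q) (hq : q ∈ homogeneousSubmodule (Fin 2) K v) : g * q ∈ U := by
        rw [hUg]; exact ⟨q, hq, rfl⟩
      simp only [LinearMap.mulLeft_apply, mul_add]
      refine V.add_mem ?_ ?_
      · obtain ⟨-, ⟨c, hc, hcu⟩⟩ := hT (hgU a ha)
        rw [mul_left_comm]
        exact hcancel 1 0 _ c hc (hcu.trans (by simp only [LinearMap.mulLeft_apply]; ring))
      · obtain ⟨⟨c, hc, hcu⟩, -⟩ := hT (hgU b hb)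
        rw [mul_left_comm]
        exact hcancel 0 1 _ c hc (hcu.trans (by simp only [LinearMap.mulLeft_apply]; ring))
    · rw [finrank_map_mulLeft hg, finrank_homogeneousSubmodule_fin_two, hV]

/-- The degree `d` part of an ideal. -/
def gradedPart (I : Ideal (Pxy K)) (d : ℕ) : Submodule K (Pxy K) :=
  homogeneousSubmodule (Fin 2) K d ⊓ I.restrictScalars K

instance (I : Ideal (Pxy K)) (d : ℕ) : Module.Finite K (gradedPart I d) :=
  Submodule.finiteDimensional_inf_left _ _

theorem hilb_add_finrank_gradedPart (I : Ideal (Pxy K)) (d : ℕ) :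
    hilb K I d + Module.finrank K (gradedPart I d) = d + 1 := by
  rw [← finrank_homogeneousSubmodule_fin_two (K := K) d, hilb,
    ← Submodule.finrank_quotient_add_finrank (Submodule.comap
      (homogeneousSubmodule (Fin 2) K d).subtype (I.restrictScalars K)), gradedPart,
    ← Submodule.map_comap_subtype, Submodule.finrank_map_subtype_eq]

/-- Where the Hilbert function stays equal to `c`, the ideal consists of the multiples of a fixed
form of degree `c`. -/
theorem exists_gradedPart_eq {I : Ideal (Pxy K)} {c d : ℕ} (hcd : c ≤ d)
    (hd : hilb K I d = c) (hd' : hilb K I (d + 1) = c) :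
    ∃ f : Pxy K, f ≠ 0 ∧ f.IsHomogeneous c ∧ ∀ j, d ≤ j → hilb K I j = c →
      gradedPart I j = (homogeneousSubmodule (Fin 2) K (j - c)).map (LinearMap.mulLeft K f) := by
  have h1 := hilb_add_finrank_gradedPart I d
  have h2 := hilb_add_finrank_gradedPart I (d + 1)
  have hmul (i : Fin 2) : (gradedPart I d).map (LinearMap.mulLeft K (X i)) ≤
      gradedPart I (d + 1) := by
    rintro _ ⟨p, ⟨hp, hpI⟩, rfl⟩
    refine ⟨?_, I.mul_mem_left _ hpI⟩
    rw [add_comm]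
    exact (isHomogeneous_X K i).mul hp
  obtain ⟨f, hf, hV⟩ := exists_eq_map_mulLeft_homogeneousSubmodule (d - c) (gradedPart I d)
    (gradedPart I (d + 1)) (by omega) (by omega) (hmul 0) (hmul 1)
  have hfI {p : Pxy K} (hp : p.IsHomogeneous (d - c)) : f * p ∈ gradedPart I d := by
    rw [hV]; exact ⟨p, hp, rfl⟩
  have hfc : f.IsHomogeneous c := by
    have h : (f * X 0 ^ (d - c)).IsHomogeneous d :=
      (hfI (isHomogeneous_X_pow (0 : Fin 2) (d - c))).1
    rw [mul_comm] at h
    refine isHomogeneous_of_mul (pow_ne_zero _ (X_ne_zero 0)) (isHomogeneous_X_pow 0 (d - c)) ?_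
    rwa [Nat.sub_add_cancel hcd]
  refine ⟨f, hf, hfc, fun j hj hcj => (Submodule.eq_of_le_of_finrank_eq ?_ ?_).symm⟩
  · have key (m : ℕ) : (homogeneousSubmodule (Fin 2) K (d - c + m)).map (LinearMap.mulLeft K f) ≤
        I.restrictScalars K := by
      induction m with
      | zero =>
        rintro _ ⟨p, hp, rfl⟩
        exact (hfI hp).2
      | succ m ih =>
        rintro _ ⟨p, hp, rfl⟩
        obtain ⟨_, ⟨a, ha, rfl⟩, _, ⟨b, hb, rfl⟩, rfl⟩ :=
          Submodule.mem_sup.mp (homogeneousSubmodule_succ_le _ hp)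
        simp only [LinearMap.mulLeft_apply, mul_add, mul_left_comm f]
        exact I.add_mem (I.mul_mem_left _ (ih ⟨a, ha, rfl⟩)) (I.mul_mem_left _ (ih ⟨b, hb, rfl⟩))
    refine le_inf ?_ ?_
    · rintro _ ⟨p, hp, rfl⟩
      have := hfc.mul hp
      rwa [Nat.add_sub_cancel' (hcd.trans hj)] at this
    · have := key (j - d)
      rwa [show d - c + (j - d) = j - c by omega] at this
  · have := hilb_add_finrank_gradedPart I j
    rw [finrank_map_mulLeft hf, finrank_homogeneousSubmodule_fin_two]
    omega

theorem dvd_of_dvd_mul_X_pow {f g : Pxy K} {a : ℕ} (h0 : g ∣ f * X 0 ^ a) (h1 : g ∣ f * X 1 ^ a) :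
    g ∣ f := by
  have hrel : IsRelPrime (X 0 ^ a : Pxy K) (X 1 ^ a) := by
    refine IsRelPrime.pow ?_
    refine (X_prime.irreducible.isRelPrime_iff_not_dvd).mpr ?_
    simp [X_dvd_X]
  let _ := UniqueFactorizationMonoid.toGCDMonoid (Pxy K)
  have h := dvd_gcd h0 h1
  have hu := (gcd_isUnit_iff_isRelPrime).mpr hrel
  exact (hu.dvd_mul_right).mp (h.trans (gcd_mul_left' f _ _).dvd)

theorem mem_pow_idealOfVars_of_isHomogeneous {σ : Type*} {p : MvPolynomial σ K} {d e : ℕ}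
    (hp : p.IsHomogeneous e) (hde : d ≤ e) : p ∈ idealOfVars σ K ^ d :=
  (mem_pow_idealOfVars_iff' d p).mpr fun _ hx => hp.coeff_eq_zero (by omega)

theorem pow_idealOfVars_le_of_isHomogeneous {σ : Type*} {d : ℕ} {J : Ideal (MvPolynomial σ K)}
    (h : ∀ p : MvPolynomial σ K, p.IsHomogeneous d → p ∈ J) : idealOfVars σ K ^ d ≤ J := by
  rw [pow_idealOfVars_eq_span, Ideal.span_le]
  rintro _ ⟨m, hm, rfl⟩
  exact h _ (isHomogeneous_monomial 1 (by simpa using hm))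

/-- The ideal `(abc) 𝔪 ^ p + (ab) 𝔪 ^ q + (a) 𝔪 ^ r + 𝔪 ^ t`, where `𝔪 = (x, y)`. -/
def flagIdeal (p q r t : ℕ) (a b c : Pxy K) : Ideal (Pxy K) :=
  Ideal.span {a * b * c} * idealOfVars (Fin 2) K ^ p ⊔
    Ideal.span {a * b} * idealOfVars (Fin 2) K ^ q ⊔
    Ideal.span {a} * idealOfVars (Fin 2) K ^ r ⊔ idealOfVars (Fin 2) K ^ t

theorem flagIdeal_congr (p q r t : ℕ) {a b c a' b' c' : Pxy K} (ha : Associated a a')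
    (hb : Associated b b') (hc : Associated c c') :
    flagIdeal p q r t a b c = flagIdeal p q r t a' b' c' := by
  rw [flagIdeal, flagIdeal, Ideal.span_singleton_eq_span_singleton.mpr ha,
    Ideal.span_singleton_eq_span_singleton.mpr (ha.mul_mul hb),
    Ideal.span_singleton_eq_span_singleton.mpr ((ha.mul_mul hb).mul_mul hc)]

theorem map_idealOfVars_le {φ : Pxy K ≃ₐ[K] Pxy K} (hφ : IsLinChange φ) :
    (idealOfVars (Fin 2) K).map φ ≤ idealOfVars (Fin 2) K := by
  rw [Ideal.map_span, Ideal.span_le]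
  rintro _ ⟨_, ⟨i, rfl⟩, rfl⟩
  simpa using mem_pow_idealOfVars_of_isHomogeneous (hφ i) le_rfl

theorem map_idealOfVars {φ : Pxy K ≃ₐ[K] Pxy K} (hφ : IsLinChange φ) (hφ' : IsLinChange φ.symm) :
    (idealOfVars (Fin 2) K).map φ = idealOfVars (Fin 2) K := by
  refine (map_idealOfVars_le hφ).antisymm ?_
  rw [Ideal.span_le]
  rintro _ ⟨i, rfl⟩
  have h := Ideal.mem_map_of_mem φ.symm (Ideal.subset_span (Set.mem_range_self i) :
    (X i : Pxy K) ∈ idealOfVars (Fin 2) K)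
  have h' := Ideal.mem_map_of_mem φ (map_idealOfVars_le hφ' h)
  rwa [AlgEquiv.apply_symm_apply] at h'

theorem map_flagIdeal {φ : Pxy K ≃ₐ[K] Pxy K} (hφ : IsLinChange φ) (hφ' : IsLinChange φ.symm)
    (p q r t : ℕ) (a b c : Pxy K) :
    (flagIdeal p q r t a b c).map φ = flagIdeal p q r t (φ a) (φ b) (φ c) := by
  simp only [flagIdeal, Ideal.map_sup, Ideal.map_mul, Ideal.map_pow, map_idealOfVars hφ hφ',
    Ideal.map_span, Set.image_singleton, map_mul]

attribute [local instance] MvPolynomial.gradedAlgebra in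
theorem isHomog_flagIdeal (p q r t : ℕ) {a b c : Pxy K} (ha : a.IsHomogeneous 1)
    (hb : b.IsHomogeneous 1) (hc : c.IsHomogeneous 1) : IsHomog (flagIdeal p q r t a b c) := by
  have hspan {f : Pxy K} {d : ℕ} (hf : f.IsHomogeneous d) :
      (Ideal.span {f}).IsHomogeneous (homogeneousSubmodule (Fin 2) K) := by
    refine Ideal.homogeneous_span _ _ ?_
    rintro _ rfl
    exact ⟨d, hf⟩
  have hpow (d : ℕ) :
      (idealOfVars (Fin 2) K ^ d).IsHomogeneous (homogeneousSubmodule (Fin 2) K) := by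
    rw [pow_idealOfVars_eq_span]
    refine Ideal.homogeneous_span _ _ ?_
    rintro _ ⟨m, hm, rfl⟩
    exact ⟨d, isHomogeneous_monomial 1 (by simpa using hm)⟩
  intro f hf k
  exact homogeneousComponent_mem_of_mem
    (((((hspan ((ha.mul hb).mul hc)).mul (hpow p)).sup ((hspan (ha.mul hb)).mul (hpow q))).sup
      ((hspan ha).mul (hpow r))).sup (hpow t)) hf k

theorem exists_isLinChange {a₀ a₁ b₀ b₁ : K} (hD : a₀ * b₁ - a₁ * b₀ ≠ 0) :
    ∃ φ : Pxy K ≃ₐ[K] Pxy K, IsLinChange φ ∧ IsLinChange φ.symm ∧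
      φ (C a₀ * X 0 + C a₁ * X 1) = X 0 ∧ φ (C b₀ * X 0 + C b₁ * X 1) = X 1 := by
  set D := a₀ * b₁ - a₁ * b₀ with hDdef
  have hlin (u v : K) : (C u * X 0 + C v * X 1 : Pxy K).IsHomogeneous 1 :=
    (isHomogeneous_C_mul_X u 0).add (isHomogeneous_C_mul_X v 1)
  let F : Pxy K →ₐ[K] Pxy K := aeval ![C (b₁ / D) * X 0 + C (-a₁ / D) * X 1,
    C (-b₀ / D) * X 0 + C (a₀ / D) * X 1]
  let G : Pxy K →ₐ[K] Pxy K := aeval ![C a₀ * X 0 + C a₁ * X 1, C b₀ * X 0 + C b₁ * X 1]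
  have hcomb (u v u' v' w w' : K) : (C u * (C v * X 0 + C w * X 1) +
      C u' * (C v' * X 0 + C w' * X 1) : Pxy K) =
      C (u * v + u' * v') * X 0 + C (u * w + u' * w') * X 1 := by
    simp only [C_add, C_mul]; ring
  have hF (u v : K) : F (C u * X 0 + C v * X 1) =
      C (u * (b₁ / D) + v * (-b₀ / D)) * X 0 + C (u * (-a₁ / D) + v * (a₀ / D)) * X 1 := by
    rw [← hcomb]
    simp [F, algebraMap_eq]
  have hG (u v : K) : G (C u * X 0 + C v * X 1) =
      C (u * a₀ + v * b₀) * X 0 + C (u * a₁ + v * b₁) * X 1 := by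
    rw [← hcomb]
    simp [G, algebraMap_eq]
  have hF0 : F (C a₀ * X 0 + C a₁ * X 1) = X 0 := by
    rw [hF, show a₀ * (b₁ / D) + a₁ * (-b₀ / D) = 1 by field_simp; rw [hDdef]; ring,
      show a₀ * (-a₁ / D) + a₁ * (a₀ / D) = 0 by ring]
    simp
  have hF1 : F (C b₀ * X 0 + C b₁ * X 1) = X 1 := by
    rw [hF, show b₀ * (-a₁ / D) + b₁ * (a₀ / D) = 1 by field_simp; rw [hDdef]; ring,
      show b₀ * (b₁ / D) + b₁ * (-b₀ / D) = 0 by ring]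
    simp
  have hFX0 : F (X 0) = C (b₁ / D) * X 0 + C (-a₁ / D) * X 1 := by simp [F]
  have hFX1 : F (X 1) = C (-b₀ / D) * X 0 + C (a₀ / D) * X 1 := by simp [F]
  have hGX0 : G (X 0) = C a₀ * X 0 + C a₁ * X 1 := by simp [G]
  have hGX1 : G (X 1) = C b₀ * X 0 + C b₁ * X 1 := by simp [G]
  have hFG : F.comp G = AlgHom.id K _ := by
    refine algHom_ext fun i => ?_
    fin_cases i
    · simpa [hGX0] using hF0
    · simpa [hGX1] using hF1
  have hGF : G.comp F = AlgHom.id K _ := by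
    refine algHom_ext fun i => ?_
    fin_cases i
    · change G (F (X 0)) = X 0
      rw [hFX0, hG, show b₁ / D * a₀ + -a₁ / D * b₀ = 1 by field_simp; rw [hDdef]; ring,
        show b₁ / D * a₁ + -a₁ / D * b₁ = 0 by ring]
      simp
    · change G (F (X 1)) = X 1
      rw [hFX1, hG, show -b₀ / D * a₁ + a₀ / D * b₁ = 1 by field_simp; rw [hDdef]; ring,
        show -b₀ / D * a₀ + a₀ / D * b₀ = 0 by ring]
      simp
  refine ⟨AlgEquiv.ofAlgHom F G hFG hGF, fun i => ?_, fun i => ?_, hF0, hF1⟩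
  · fin_cases i
    · exact hFX0 ▸ hlin _ _
    · exact hFX1 ▸ hlin _ _
  · fin_cases i
    · exact hGX0 ▸ hlin _ _
    · exact hGX1 ▸ hlin _ _

/-- Representatives of up to three distinct points of the projective line. -/
def standardForms (K : Type*) [Field K] : Set (Pxy K) := {X 0, X 1, X 0 + X 1}

theorem isHomogeneous_of_mem_standardForms {m : Pxy K} (hm : m ∈ standardForms K) :
    m.IsHomogeneous 1 := by
  rcases hm with rfl | rfl | rfl
  · exact isHomogeneous_X K 0
  · exact isHomogeneous_X K 1
  · exact (isHomogeneous_X K 0).add (isHomogeneous_X K 1)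

theorem associated_C_mul {u : K} (hu : u ≠ 0) (p : Pxy K) : Associated (C u * p) p :=
  associated_unit_mul_left p _ (hu.isUnit.map C)

theorem associated_of_det_eq_zero {a₀ a₁ b₀ b₁ : K} (ha : (C a₀ * X 0 + C a₁ * X 1 : Pxy K) ≠ 0)
    (hb : (C b₀ * X 0 + C b₁ * X 1 : Pxy K) ≠ 0) (hD : a₀ * b₁ - a₁ * b₀ = 0) :
    Associated (C b₀ * X 0 + C b₁ * X 1 : Pxy K) (C a₀ * X 0 + C a₁ * X 1) := by
  obtain ⟨u, h0, h1⟩ : ∃ u : K, b₀ = u * a₀ ∧ b₁ = u * a₁ := by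
    by_cases h : a₀ = 0
    · have h' : a₁ ≠ 0 := by rintro rfl; simp [h] at ha
      refine ⟨b₁ / a₁, ?_, by field_simp⟩
      have : a₁ * b₀ = 0 := by rw [h] at hD; linear_combination -hD
      simpa [h, h'] using this
    · refine ⟨b₀ / a₀, by field_simp, ?_⟩
      field_simp
      linear_combination hD
  have he : (C b₀ * X 0 + C b₁ * X 1 : Pxy K) = C u * (C a₀ * X 0 + C a₁ * X 1) := by
    rw [h0, h1, C_mul, C_mul]; ring
  have hu : u ≠ 0 := by
    rintro rfl
    simp [he] at hb
  rw [he]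
  exact associated_C_mul hu _

theorem exists_isLinChange_associated_of_det_ne_zero {a₀ a₁ b₀ b₁ : K}
    (hD : a₀ * b₁ - a₁ * b₀ ≠ 0) {c₀ c₁ : K} (hc : (C c₀ * X 0 + C c₁ * X 1 : Pxy K) ≠ 0) :
    ∃ φ : Pxy K ≃ₐ[K] Pxy K, IsLinChange φ ∧ IsLinChange φ.symm ∧
      (∃ m ∈ standardForms K, Associated (φ (C a₀ * X 0 + C a₁ * X 1)) m) ∧
      (∃ m ∈ standardForms K, Associated (φ (C b₀ * X 0 + C b₁ * X 1)) m) ∧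
      ∃ m ∈ standardForms K, Associated (φ (C c₀ * X 0 + C c₁ * X 1)) m := by
  obtain ⟨α, hα⟩ : ∃ α, α * (a₀ * b₁ - a₁ * b₀) = c₀ * b₁ - c₁ * b₀ := ⟨_, div_mul_cancel₀ _ hD⟩
  obtain ⟨β, hβ⟩ : ∃ β, β * (a₀ * b₁ - a₁ * b₀) = a₀ * c₁ - a₁ * c₀ := ⟨_, div_mul_cancel₀ _ hD⟩
  have h0 : c₀ = α * a₀ + β * b₀ := by
    refine mul_right_cancel₀ hD ?_
    linear_combination -a₀ * hα - b₀ * hβ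
  have h1 : c₁ = α * a₁ + β * b₁ := by
    refine mul_right_cancel₀ hD ?_
    linear_combination -a₁ * hα - b₁ * hβ
  have hφC (φ : Pxy K ≃ₐ[K] Pxy K) (u : K) : φ (C u) = C u := φ.commutes u
  have hsum : (C c₀ * X 0 + C c₁ * X 1 : Pxy K) =
      C α * (C a₀ * X 0 + C a₁ * X 1) + C β * (C b₀ * X 0 + C b₁ * X 1) := by
    rw [h0, h1]; simp only [C_add, C_mul]; ring
  by_cases hα0 : α = 0
  · have hβ0 : β ≠ 0 := by rintro rfl; simp [hsum, hα0] at hc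
    obtain ⟨φ, hφ, hφ', ha, hb⟩ := exists_isLinChange hD
    refine ⟨φ, hφ, hφ', ⟨X 0, by simp [standardForms], by rw [ha]⟩,
      ⟨X 1, by simp [standardForms], by rw [hb]⟩, X 1, by simp [standardForms], ?_⟩
    rw [hsum, hα0, C_0, zero_mul, zero_add, map_mul, hφC, hb]
    exact associated_C_mul hβ0 _
  by_cases hβ0 : β = 0
  · obtain ⟨φ, hφ, hφ', ha, hb⟩ := exists_isLinChange hD
    refine ⟨φ, hφ, hφ', ⟨X 0, by simp [standardForms], by rw [ha]⟩,
      ⟨X 1, by simp [standardForms], by rw [hb]⟩, X 0, by simp [standardForms], ?_⟩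
    rw [hsum, hβ0, C_0, zero_mul, add_zero, map_mul, hφC, ha]
    exact associated_C_mul hα0 _
  · obtain ⟨φ, hφ, hφ', ha, hb⟩ := exists_isLinChange
      (a₀ := α * a₀) (a₁ := α * a₁) (b₀ := β * b₀) (b₁ := β * b₁) (by
        rw [show α * a₀ * (β * b₁) - α * a₁ * (β * b₀) = α * β * (a₀ * b₁ - a₁ * b₀) by ring]
        exact mul_ne_zero (mul_ne_zero hα0 hβ0) hD)
    have hs (u v w : K) : (C (u * v) * X 0 + C (u * w) * X 1 : Pxy K) =
        C u * (C v * X 0 + C w * X 1) := by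
      simp only [C_mul]; ring
    rw [hs, map_mul, hφC] at ha hb
    refine ⟨φ, hφ, hφ', ⟨X 0, by simp [standardForms], ?_⟩,
      ⟨X 1, by simp [standardForms], ?_⟩, X 0 + X 1, by simp [standardForms], ?_⟩
    · have h := associated_C_mul hα0 (φ (C a₀ * X 0 + C a₁ * X 1))
      rw [ha] at h
      exact h.symm
    · have h := associated_C_mul hβ0 (φ (C b₀ * X 0 + C b₁ * X 1))
      rw [hb] at h
      exact h.symm
    · rw [hsum, map_add, map_mul, map_mul, hφC, hφC, ha, hb]

theorem exists_isLinChange_associated {a b c : Pxy K} (ha : a.IsHomogeneous 1)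
    (hb : b.IsHomogeneous 1) (hc : c.IsHomogeneous 1) (ha0 : a ≠ 0) (hb0 : b ≠ 0) (hc0 : c ≠ 0) :
    ∃ φ : Pxy K ≃ₐ[K] Pxy K, IsLinChange φ ∧ IsLinChange φ.symm ∧
      (∃ m ∈ standardForms K, Associated (φ a) m) ∧
      (∃ m ∈ standardForms K, Associated (φ b) m) ∧
      ∃ m ∈ standardForms K, Associated (φ c) m := by
  obtain ⟨a₀, a₁, rfl⟩ := exists_eq_of_isHomogeneous_one ha
  obtain ⟨b₀, b₁, rfl⟩ := exists_eq_of_isHomogeneous_one hb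
  obtain ⟨c₀, c₁, rfl⟩ := exists_eq_of_isHomogeneous_one hc
  have htrans {φ : Pxy K ≃ₐ[K] Pxy K} {p q : Pxy K} (h : Associated p q) :
      (∃ m ∈ standardForms K, Associated (φ q) m) → ∃ m ∈ standardForms K, Associated (φ p) m :=
    fun ⟨m, hm, hqm⟩ => ⟨m, hm, (h.map φ).trans hqm⟩
  by_cases hab : a₀ * b₁ - a₁ * b₀ = 0
  · have hab' := associated_of_det_eq_zero ha0 hb0 hab
    by_cases hac : a₀ * c₁ - a₁ * c₀ = 0
    · have hac' := associated_of_det_eq_zero ha0 hc0 hac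
      obtain ⟨d₀, d₁, hd⟩ : ∃ d₀ d₁ : K, a₀ * d₁ - a₁ * d₀ ≠ 0 := by
        by_cases h : a₀ = 0
        · refine ⟨1, 0, ?_⟩
          rintro h'
          have : a₁ = 0 := by linear_combination -h'
          simp [h, this] at ha0
        · exact ⟨0, 1, by simpa using h⟩
      obtain ⟨φ, hφ, hφ', hma, -, -⟩ := exists_isLinChange_associated_of_det_ne_zero hd ha0
      exact ⟨φ, hφ, hφ', hma, htrans hab' hma, htrans hac' hma⟩
    · obtain ⟨φ, hφ, hφ', hma, hmc, -⟩ := exists_isLinChange_associated_of_det_ne_zero hac ha0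
      exact ⟨φ, hφ, hφ', hma, htrans hab' hma, hmc⟩
  · exact exists_isLinChange_associated_of_det_ne_zero hab hc0

theorem dvd_of_gradedPart_eq {I : Ideal (Pxy K)} {f g : Pxy K} {c e d d' : ℕ}
    (hf : f.IsHomogeneous c) (hfI : ∀ p : Pxy K, p.IsHomogeneous d → f * p ∈ I)
    (hg : gradedPart I e = (homogeneousSubmodule (Fin 2) K d').map (LinearMap.mulLeft K g))
    (hcd : c + d ≤ e) : g ∣ f := by
  have key (i : Fin 2) : g ∣ f * X i ^ (e - c) := by
    have hmem : f * X i ^ (e - c) ∈ gradedPart I e := by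
      refine ⟨?_, ?_⟩
      · have := hf.mul (isHomogeneous_X_pow (R := K) i (e - c))
        rwa [Nat.add_sub_cancel' (by omega)] at this
      · rw [show e - c = d + (e - c - d) by omega, pow_add, ← mul_assoc]
        exact I.mul_mem_right _ (hfI _ (isHomogeneous_X_pow i d))
    rw [hg] at hmem
    obtain ⟨q, -, hq⟩ := hmem
    exact ⟨q, hq.symm⟩
  exact dvd_of_dvd_mul_X_pow (key 0) (key 1)

theorem eq_flagIdeal_of_hilb {I : Ideal (Pxy K)} (hI : IsHomog I) {n k l s : ℕ} (hn : 3 ≤ n)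
    (hk : 1 ≤ k) (hl : 2 ≤ l) (hs : 2 ≤ s)
    (ht : ∀ j, hilb K I j = if j < n then j + 1 else if j ≤ n + k then 3
      else if j ≤ n + k + l then 2 else if j ≤ n + k + l + s then 1 else 0) :
    ∃ a b c : Pxy K, a.IsHomogeneous 1 ∧ b.IsHomogeneous 1 ∧ c.IsHomogeneous 1 ∧
      a ≠ 0 ∧ b ≠ 0 ∧ c ≠ 0 ∧
      I = flagIdeal (n - 3) (n + k - 1) (n + k + l) (n + k + l + s + 1) a b c := by
  have t3 (j : ℕ) (h1 : n ≤ j) (h2 : j ≤ n + k) : hilb K I j = 3 := by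
    rw [ht]; split_ifs <;> omega
  have t2 (j : ℕ) (h1 : n + k + 1 ≤ j) (h2 : j ≤ n + k + l) : hilb K I j = 2 := by
    rw [ht]; split_ifs <;> omega
  have t1 (j : ℕ) (h1 : n + k + l + 1 ≤ j) (h2 : j ≤ n + k + l + s) : hilb K I j = 1 := by
    rw [ht]; split_ifs <;> omega
  obtain ⟨f, hf0, hf, hfI⟩ := exists_gradedPart_eq (I := I) hn (t3 n le_rfl (by omega))
    (t3 (n + 1) (by omega) (by omega))
  obtain ⟨g, hg0, hg, hgI⟩ := exists_gradedPart_eq (I := I) (c := 2) (d := n + k + 1) (by omega)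
    (t2 _ le_rfl (by omega)) (t2 _ (by omega) (by omega))
  obtain ⟨a, ha0, ha, haI⟩ := exists_gradedPart_eq (I := I) (c := 1) (d := n + k + l + 1) (by omega)
    (t1 _ le_rfl (by omega)) (t1 _ (by omega) (by omega))
  have hmul {h : Pxy K} {c d e : ℕ} (he : gradedPart I d =
      (homogeneousSubmodule (Fin 2) K (d - c)).map (LinearMap.mulLeft K h)) (hd : d - c = e)
      (p : Pxy K) (hp : p.IsHomogeneous e) : h * p ∈ I := by
    have : h * p ∈ gradedPart I d := by
      rw [he, hd]; exact ⟨p, hp, rfl⟩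
    exact this.2
  have hf' := hmul (hfI n le_rfl (t3 n le_rfl (by omega))) rfl
  have hg' := hmul (hgI _ le_rfl (t2 _ le_rfl (by omega))) (e := n + k - 1) (by omega)
  have ha' := hmul (haI _ le_rfl (t1 _ le_rfl (by omega))) (e := n + k + l) (by omega)
  obtain ⟨b, rfl⟩ := dvd_of_gradedPart_eq hg hg' (haI _ le_rfl (t1 _ le_rfl (by omega))) (by omega)
  obtain ⟨c, rfl⟩ := dvd_of_gradedPart_eq hf hf' (hgI _ le_rfl (t2 _ le_rfl (by omega))) (by omega)
  refine ⟨a, b, c, ha, isHomogeneous_of_mul ha0 ha hg, isHomogeneous_of_mul hg0 hg hf, ha0,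
    right_ne_zero_of_mul hg0, right_ne_zero_of_mul hf0, le_antisymm ?_ ?_⟩
  · intro p hp
    rw [← sum_homogeneousComponent p]
    refine Ideal.sum_mem _ fun j _ => ?_
    have hj : homogeneousComponent j p ∈ gradedPart I j :=
      ⟨homogeneousComponent_isHomogeneous j p, hI p hp j⟩
    have hspan {h u : Pxy K} {d e : ℕ} (hu : u.IsHomogeneous e) (hde : d ≤ e) :
        h * u ∈ Ideal.span {h} * idealOfVars (Fin 2) K ^ d :=
      Ideal.mul_mem_mul (Ideal.mem_span_singleton_self h)
        (mem_pow_idealOfVars_of_isHomogeneous hu hde)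
    by_cases h3 : j < n
    · have hr := hilb_add_finrank_gradedPart I j
      rw [ht, if_pos h3, Nat.add_eq_left, Submodule.finrank_eq_zero] at hr
      rw [hr, Submodule.mem_bot] at hj
      rw [hj]
      exact zero_mem _
    by_cases h2 : j ≤ n + k
    · rw [hfI j (by omega) (t3 j (by omega) h2)] at hj
      obtain ⟨u, hu, hup⟩ := hj
      rw [← hup]
      exact Ideal.mem_sup_left (Ideal.mem_sup_left (Ideal.mem_sup_left (hspan hu (by omega))))
    by_cases h1 : j ≤ n + k + l
    · rw [hgI j (by omega) (t2 j (by omega) h1)] at hj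
      obtain ⟨u, hu, hup⟩ := hj
      rw [← hup]
      exact Ideal.mem_sup_left (Ideal.mem_sup_left (Ideal.mem_sup_right (hspan hu (by omega))))
    by_cases h0 : j ≤ n + k + l + s
    · rw [haI j (by omega) (t1 j (by omega) h0)] at hj
      obtain ⟨u, hu, hup⟩ := hj
      rw [← hup]
      exact Ideal.mem_sup_left (Ideal.mem_sup_right (hspan hu (by omega)))
    · exact Ideal.mem_sup_right (mem_pow_idealOfVars_of_isHomogeneous hj.1 (by omega))
  · have hle {h : Pxy K} {d : ℕ} (hd : ∀ p : Pxy K, p.IsHomogeneous d → h * p ∈ I) :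
        Ideal.span {h} * idealOfVars (Fin 2) K ^ d ≤ I := by
      rw [mul_comm, Ideal.mul_le]
      intro p hp q hq
      obtain ⟨v, rfl⟩ := Ideal.mem_span_singleton'.mp hq
      have hp' : p ∈ Submodule.comap (LinearMap.mulLeft (Pxy K) h) I :=
        pow_idealOfVars_le_of_isHomogeneous hd hp
      rw [show p * (v * h) = v * (h * p) by ring]
      exact I.mul_mem_left v hp'
    refine sup_le (sup_le (sup_le (hle hf') (hle hg')) (hle ha'))
      (pow_idealOfVars_le_of_isHomogeneous fun p hp => ?_)
    have hr := hilb_add_finrank_gradedPart I (n + k + l + s + 1)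
    have htop : gradedPart I (n + k + l + s + 1) = homogeneousSubmodule (Fin 2) K _ :=
      Submodule.eq_of_le_of_finrank_eq inf_le_left (by
        rw [finrank_homogeneousSubmodule_fin_two, ← hr, ht]
        simp only [show ¬ n + k + l + s + 1 < n by omega,
          show ¬ n + k + l + s + 1 ≤ n + k by omega, show ¬ n + k + l + s + 1 ≤ n + k + l by omega,
          show ¬ n + k + l + s + 1 ≤ n + k + l + s by omega, if_false, zero_add])
    exact (htop.ge hp).2

end

/-- The sequence `T₁₁ = (1, 2, …, n, 3, …, 3, 2, …, 2, 1, …, 1)` is of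
homogeneous finite type. -/
theorem stmt13 (K : Type*) [Field K] [IsAlgClosed K] [CharZero K]
    (n k l s : ℕ) (hn : 3 ≤ n) (hk : 1 ≤ k) (hl : 2 ≤ l) (hs : 2 ≤ s) :
    HomogFiniteType K
      (fun j => if j < n then j + 1 else if j ≤ n + k then 3
        else if j ≤ n + k + l then 2 else if j ≤ n + k + l + s then 1 else 0) := by
  let J : Pxy K × Pxy K × Pxy K → Ideal (Pxy K) := fun m =>
    flagIdeal (n - 3) (n + k - 1) (n + k + l) (n + k + l + s + 1) m.1 m.2.1 m.2.2
  have hfin : (standardForms K).Finite := by simp [standardForms]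
  refine ⟨J '' (standardForms K ×ˢ standardForms K ×ˢ standardForms K),
    (hfin.prod (hfin.prod hfin)).image J, ?_, fun I hI ht => ?_⟩
  · rintro _ ⟨⟨a, b, c⟩, ⟨ha, hb, hc⟩, rfl⟩
    exact isHomog_flagIdeal _ _ _ _ (isHomogeneous_of_mem_standardForms ha)
      (isHomogeneous_of_mem_standardForms hb) (isHomogeneous_of_mem_standardForms hc)
  · obtain ⟨a, b, c, ha, hb, hc, ha0, hb0, hc0, rfl⟩ := eq_flagIdeal_of_hilb hI hn hk hl hs ht
    obtain ⟨φ, hφ, hφ', ⟨a', ha', haa'⟩, ⟨b', hb', hbb'⟩, ⟨c', hc', hcc'⟩⟩ :=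
      exists_isLinChange_associated ha hb hc ha0 hb0 hc0
    refine ⟨φ, hφ, (a', b', c'), ⟨ha', hb', hc'⟩, ?_⟩
    rw [map_flagIdeal hφ hφ']
    exact (flagIdeal_congr _ _ _ _ haa' hbb' hcc').symm
end
end

section
/- Let K be a field and let I_1, I_2 be homogeneous ideals of K[x,y] contained in the ideal (x,y) such that K[x,y]/I_1 and K[x,y]/I_2 are finite-dimensional over K. If K[x,y]/I_1 and K[x,y]/I_2 are isomorphic as K-algebras, then there exists a linear change of variables φ of K[x,y] with φ(I_1) = I_2. -/
open MvPolynomial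

noncomputable section

section LinearAlgebra

variable {K V : Type*} [Field K] [AddCommGroup V] [Module K V] [FiniteDimensional K V]

/-- A linear map inducing an isomorphism `V ⧸ W₁ ≃ V ⧸ W₂` agrees modulo `W₂` with an
automorphism of `V`. -/
lemma exists_linearEquiv_sub_mem (W₁ W₂ : Submodule K V) (L M : V →ₗ[K] V)
    (hL : ∀ v ∈ W₁, L v ∈ W₂) (hM : ∀ v ∈ W₂, M v ∈ W₁)
    (hML : ∀ v, M (L v) - v ∈ W₁) (hLM : ∀ v, L (M v) - v ∈ W₂) :
    ∃ e : V ≃ₗ[K] V, ∀ v, e v - L v ∈ W₂ := by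
  let q : (V ⧸ W₁) ≃ₗ[K] (V ⧸ W₂) := LinearEquiv.ofLinearMap
    (W₁.mapQ W₂ L hL) (W₂.mapQ W₁ M hM)
    (by ext v; simpa using (Submodule.Quotient.eq W₂).2 (hLM v))
    (by ext v; simpa using (Submodule.Quotient.eq W₁).2 (hML v))
  have hrank : Module.finrank K W₁ = Module.finrank K W₂ := by
    have h1 := W₁.finrank_quotient_add_finrank
    have h2 := W₂.finrank_quotient_add_finrank
    have h3 := q.finrank_eq
    omega
  obtain ⟨C₁, hC₁⟩ := W₁.exists_isCompl
  obtain ⟨C₂, hC₂⟩ := W₂.exists_isCompl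
  let c : C₁ ≃ₗ[K] C₂ := (Submodule.quotientEquivOfIsCompl W₁ C₁ hC₁).symm ≪≫ₗ q ≪≫ₗ
    Submodule.quotientEquivOfIsCompl W₂ C₂ hC₂
  have hc : ∀ x : C₁, (c x : V) - L x ∈ W₂ := by
    intro x
    rw [← Submodule.Quotient.eq]
    simp only [c, LinearEquiv.trans_apply, Submodule.mk_quotientEquivOfIsCompl_apply]
    rfl
  let w : W₁ ≃ₗ[K] W₂ := LinearEquiv.ofFinrankEq _ _ hrank
  refine ⟨(Submodule.prodEquivOfIsCompl W₁ C₁ hC₁).symm ≪≫ₗ (w.prodCongr c) ≪≫ₗ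
    Submodule.prodEquivOfIsCompl W₂ C₂ hC₂, fun v => ?_⟩
  obtain ⟨⟨a, b⟩, rfl⟩ := (Submodule.prodEquivOfIsCompl W₁ C₁ hC₁).surjective v
  rw [LinearEquiv.trans_apply, LinearEquiv.trans_apply, LinearEquiv.symm_apply_apply]
  simp only [LinearEquiv.prodCongr_apply, Submodule.coe_prodEquivOfIsCompl', map_add]
  have : (w a : V) + c b - (L a + L b) = w a - L a + (c b - L b) := by abel
  rw [this]
  exact add_mem (sub_mem (w a).2 (hL _ a.2)) (hc b)

end LinearAlgebra

namespace MvPolynomial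

variable {σ K : Type*} [Field K]

lemma mem_idealOfVars_iff_coeff_zero {p : MvPolynomial σ K} :
    p ∈ idealOfVars σ K ↔ coeff 0 p = 0 := by
  rw [← pow_one (idealOfVars σ K), mem_pow_idealOfVars_iff']
  simp [Finsupp.degree_eq_zero_iff]

lemma homogeneousComponent_eq_zero_of_mem_pow {p : MvPolynomial σ K} {n k : ℕ}
    (hp : p ∈ idealOfVars σ K ^ n) (hk : k < n) : homogeneousComponent k p = 0 := by
  rw [mem_pow_idealOfVars_iff'] at hp
  ext d
  rw [coeff_homogeneousComponent, coeff_zero]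
  split_ifs with h
  · exact hp d (h ▸ hk)
  · rfl

lemma pow_sub_pow_mem_pow_idealOfVars {p l : MvPolynomial σ K}
    (hp : p ∈ idealOfVars σ K) (hl : l ∈ idealOfVars σ K)
    (hpl : p - l ∈ idealOfVars σ K ^ 2) (n : ℕ) :
    p ^ n - l ^ n ∈ idealOfVars σ K ^ (n + 1) := by
  induction n with
  | zero => simp
  | succ n ih =>
    have : p ^ (n + 1) - l ^ (n + 1) = (p ^ n - l ^ n) * p + l ^ n * (p - l) := by ring
    rw [this, pow_succ _ (n + 1)]
    refine add_mem (Ideal.mul_mem_mul ih hp) ?_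
    rw [← pow_succ, show n + 1 + 1 = n + 2 from rfl, pow_add]
    exact Ideal.mul_mem_mul (Ideal.pow_mem_pow hl n) hpl

lemma finsuppProd_pow_mem {p : σ → MvPolynomial σ K}
    (hp : ∀ i, p i ∈ idealOfVars σ K) (d : σ →₀ ℕ) :
    (d.prod fun i n => p i ^ n) ∈ idealOfVars σ K ^ d.degree := by
  induction d using Finsupp.induction_linear with
  | zero => simp
  | add d e hd he =>
    rw [Finsupp.prod_add_index' (by simp) (fun _ _ _ => pow_add _ _ _), map_add, pow_add]
    exact Ideal.mul_mem_mul hd he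
  | single i n => simpa using Ideal.pow_mem_pow (hp i) n

lemma finsuppProd_pow_sub_mem {p l : σ → MvPolynomial σ K}
    (hp : ∀ i, p i ∈ idealOfVars σ K) (hl : ∀ i, l i ∈ idealOfVars σ K)
    (hpl : ∀ i, p i - l i ∈ idealOfVars σ K ^ 2) (d : σ →₀ ℕ) :
    (d.prod fun i n => p i ^ n) - (d.prod fun i n => l i ^ n) ∈
      idealOfVars σ K ^ (d.degree + 1) := by
  induction d using Finsupp.induction_linear with
  | zero => simp
  | add d e hd he =>
    rw [Finsupp.prod_add_index' (by simp) (fun _ _ _ => pow_add _ _ _),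
      Finsupp.prod_add_index' (by simp) (fun _ _ _ => pow_add _ _ _), map_add]
    set a := d.prod fun i n => p i ^ n
    set a' := d.prod fun i n => l i ^ n
    set b := e.prod fun i n => p i ^ n
    set b' := e.prod fun i n => l i ^ n
    have : a * b - a' * b' = (a - a') * b + a' * (b - b') := by ring
    rw [this]
    refine add_mem ?_ ?_
    · rw [add_right_comm, pow_add]
      exact Ideal.mul_mem_mul hd (finsuppProd_pow_mem hp e)
    · rw [add_assoc, pow_add]
      exact Ideal.mul_mem_mul (finsuppProd_pow_mem hl d) he
  | single i n => simpa using pow_sub_pow_mem_pow_idealOfVars (hp i) (hl i) (hpl i) n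

lemma aeval_sub_aeval_mem_of_isHomogeneous {p l : σ → MvPolynomial σ K}
    (hp : ∀ i, p i ∈ idealOfVars σ K) (hl : ∀ i, l i ∈ idealOfVars σ K)
    (hpl : ∀ i, p i - l i ∈ idealOfVars σ K ^ 2) {g : MvPolynomial σ K} {k : ℕ}
    (hg : g.IsHomogeneous k) :
    aeval p g - aeval l g ∈ idealOfVars σ K ^ (k + 1) := by
  rw [g.as_sum, map_sum, map_sum, ← Finset.sum_sub_distrib]
  refine sum_mem fun d hd => ?_
  rw [aeval_monomial, aeval_monomial, ← mul_sub]
  have hdk : d.degree = k := by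
    by_contra h
    exact mem_support_iff.1 hd (hg.coeff_eq_zero h)
  exact Ideal.mul_mem_left _ _ (hdk ▸ finsuppProd_pow_sub_mem hp hl hpl d)

lemma aeval_mem_pow_idealOfVars {p : σ → MvPolynomial σ K} (hp : ∀ i, p i ∈ idealOfVars σ K)
    {n : ℕ} {f : MvPolynomial σ K} (hf : f ∈ idealOfVars σ K ^ n) :
    aeval p f ∈ idealOfVars σ K ^ n := by
  have h : idealOfVars σ K ≤ (idealOfVars σ K).comap (aeval p) := by
    rw [Ideal.span_le]
    rintro _ ⟨i, rfl⟩
    simpa using hp i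
  exact Ideal.le_comap_pow (aeval p) n (Ideal.pow_right_mono h n hf)

section LinearForm

variable [Fintype σ]

/-- The linear form with the given coefficients. -/
def linearForm : (σ → K) →ₗ[K] MvPolynomial σ K where
  toFun v := ∑ i, v i • X i
  map_add' v w := by simp [add_smul, Finset.sum_add_distrib]
  map_smul' c v := by simp [mul_smul, Finset.smul_sum]

/-- The coefficients of the linear part of a polynomial. -/
def linearCoeff : MvPolynomial σ K →ₗ[K] (σ → K) :=
  LinearMap.pi fun i => lcoeff K (Finsupp.single i 1)

lemma linearForm_apply (v : σ → K) : linearForm v = ∑ i, v i • (X i : MvPolynomial σ K) := rfl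

lemma linearForm_isHomogeneous (v : σ → K) : (linearForm v).IsHomogeneous 1 := by
  rw [linearForm_apply]
  refine IsHomogeneous.sum _ _ _ fun i _ => ?_
  rw [smul_eq_C_mul]
  simpa using (isHomogeneous_C σ (v i)).mul (isHomogeneous_X K i)

lemma linearForm_mem_idealOfVars (v : σ → K) : linearForm v ∈ idealOfVars σ K := by
  rw [linearForm_apply]
  refine sum_mem fun i _ => ?_
  rw [smul_eq_C_mul]
  exact Ideal.mul_mem_left _ _ (Ideal.subset_span ⟨i, rfl⟩)

lemma linearCoeff_linearForm (v : σ → K) : linearCoeff (linearForm v) = v := by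
  classical
  ext i
  simp [linearCoeff, linearForm_apply, coeff_X, Finsupp.single_left_inj]

lemma linearForm_single [DecidableEq σ] (i : σ) :
    linearForm (Pi.single i 1) = (X i : MvPolynomial σ K) := by
  simp [linearForm_apply, Pi.single_apply]

lemma linearForm_linearCoeff (p : MvPolynomial σ K) :
    linearForm (linearCoeff p) = homogeneousComponent 1 p := by
  classical
  ext d
  rw [coeff_homogeneousComponent]
  split_ifs with h
  · obtain ⟨i, rfl⟩ : ∃ i, d = Finsupp.single i 1 := by
      have hd : d ≠ 0 := by rintro rfl; simp at h
      obtain ⟨i, hi⟩ := Finsupp.support_nonempty_iff.2 hd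
      obtain ⟨c, rfl⟩ := le_iff_exists_add'.1 (show Finsupp.single i 1 ≤ d by
        rw [Finsupp.single_le_iff]
        exact Nat.one_le_iff_ne_zero.2 (Finsupp.mem_support_iff.1 hi))
      have hc : c = 0 := by simpa [Finsupp.degree_eq_zero_iff] using h
      exact ⟨i, by simp [hc]⟩
    exact congrFun (linearCoeff_linearForm (linearCoeff p)) i
  · exact (linearForm_isHomogeneous _).coeff_eq_zero h

lemma sub_linearForm_linearCoeff_mem {p : MvPolynomial σ K} (hp : p ∈ idealOfVars σ K) :
    p - linearForm (linearCoeff p) ∈ idealOfVars σ K ^ 2 := by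
  rw [mem_pow_idealOfVars_iff', linearForm_linearCoeff]
  intro d hd
  rw [coeff_sub, coeff_homogeneousComponent]
  split_ifs with h
  · simp
  · have : d = 0 := by
      rw [← Finsupp.degree_eq_zero_iff]
      omega
    simp [this, mem_idealOfVars_iff_coeff_zero.1 hp]

lemma linearCoeff_eq_zero_of_mem {p : MvPolynomial σ K} (hp : p ∈ idealOfVars σ K ^ 2) :
    linearCoeff p = 0 := by
  rw [← linearCoeff_linearForm (linearCoeff p), linearForm_linearCoeff,
    homogeneousComponent_eq_zero_of_mem_pow hp one_lt_two, map_zero]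

lemma linearCoeff_aeval_linearForm_linearCoeff {p : σ → MvPolynomial σ K}
    (hp : ∀ i, p i ∈ idealOfVars σ K) {f : MvPolynomial σ K} (hf : f ∈ idealOfVars σ K) :
    linearCoeff (aeval p (linearForm (linearCoeff f))) = linearCoeff (aeval p f) := by
  have := linearCoeff_eq_zero_of_mem
    (aeval_mem_pow_idealOfVars hp (sub_linearForm_linearCoeff_mem hf))
  rw [map_sub, map_sub, sub_eq_zero] at this
  exact this.symm

lemma aeval_linearForm_single [DecidableEq σ] (e : (σ → K) →ₗ[K] (σ → K)) (v : σ → K) :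
    aeval (fun i => linearForm (e (Pi.single i 1))) (linearForm v) =
      (linearForm (e v) : MvPolynomial σ K) := by
  conv_rhs => rw [← Finset.univ_sum_single v]
  simp only [linearForm_apply v, map_sum, map_smul, aeval_X]
  refine Finset.sum_congr rfl fun i _ => ?_
  rw [← map_smul, ← map_smul, ← Pi.single_smul, smul_eq_mul, mul_one]

/-- The linear change of variables induced by an automorphism of the space of linear forms. -/
def linearChange [DecidableEq σ] (e : (σ → K) ≃ₗ[K] (σ → K)) :
    MvPolynomial σ K ≃ₐ[K] MvPolynomial σ K :=
  AlgEquiv.ofAlgHom (aeval fun i => linearForm (e (Pi.single i 1)))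
    (aeval fun i => linearForm (e.symm (Pi.single i 1)))
    (algHom_ext fun i => by
      simpa [linearForm_single] using
        aeval_linearForm_single (e : (σ → K) →ₗ[K] (σ → K)) (e.symm (Pi.single i 1)))
    (algHom_ext fun i => by
      simpa [linearForm_single] using
        aeval_linearForm_single (e.symm : (σ → K) →ₗ[K] (σ → K)) (e (Pi.single i 1)))

lemma linearChange_apply [DecidableEq σ] (e : (σ → K) ≃ₗ[K] (σ → K)) (f : MvPolynomial σ K) :
    linearChange e f = aeval (fun i => linearForm (e (Pi.single i 1))) f := rfl

end LinearForm

lemma exists_X_pow_mem {I : Ideal (MvPolynomial σ K)}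
    (hI : ∀ f ∈ I, ∀ k, homogeneousComponent k f ∈ I)
    [FiniteDimensional K (MvPolynomial σ K ⧸ I)] (i : σ) : ∃ n, (X i) ^ n ∈ I := by
  obtain ⟨q, hq, hq0⟩ := Algebra.IsIntegral.isIntegral (R := K) (Ideal.Quotient.mk I (X i))
  have hmem : Polynomial.aeval (X i) q ∈ I := by
    rw [← Ideal.Quotient.eq_zero_iff_mem, ← Ideal.Quotient.mkₐ_eq_mk K,
      ← Polynomial.aeval_algHom_apply]
    exact hq0
  refine ⟨q.natDegree, ?_⟩
  convert hI _ hmem q.natDegree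
  rw [Polynomial.aeval_eq_sum_range, map_sum, Finset.sum_eq_single q.natDegree]
  · rw [hq.coeff_natDegree, one_smul, homogeneousComponent_eq_self (isHomogeneous_X_pow i _)]
  · intro j _ hj
    rw [map_smul, homogeneousComponent_of_mem (isHomogeneous_X_pow i j), if_neg hj.symm, smul_zero]
  · simp

/-- Any lift of an algebra morphism between quotients by ideals, the first of which is homogeneous
of finite codimension and the second of which is proper and supported at the origin, preserves the
origin. -/
lemma mem_idealOfVars_of_mk_eq {I J : Ideal (MvPolynomial σ K)}
    (hI : ∀ f ∈ I, ∀ k, homogeneousComponent k f ∈ I) (hJ : J ≤ idealOfVars σ K)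
    [FiniteDimensional K (MvPolynomial σ K ⧸ I)]
    (f : (MvPolynomial σ K ⧸ I) →ₐ[K] (MvPolynomial σ K ⧸ J)) {i : σ} {p : MvPolynomial σ K}
    (hp : Ideal.Quotient.mk J p = f (Ideal.Quotient.mk I (X i))) : p ∈ idealOfVars σ K := by
  obtain ⟨n, hn⟩ := exists_X_pow_mem hI i
  have : p ^ n ∈ J := by
    rw [← Ideal.Quotient.eq_zero_iff_mem, map_pow, hp, ← map_pow, ← map_pow,
      Ideal.Quotient.eq_zero_iff_mem.2 hn, map_zero]
  have h0 := mem_idealOfVars_iff_coeff_zero.1 (hJ this)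
  rw [← constantCoeff_eq, map_pow] at h0
  rw [mem_idealOfVars_iff_coeff_zero, ← constantCoeff_eq]
  exact eq_zero_of_pow_eq_zero h0

lemma mk_aeval_of_mk_eq {I J : Ideal (MvPolynomial σ K)}
    (f : (MvPolynomial σ K ⧸ I) →ₐ[K] (MvPolynomial σ K ⧸ J)) {p : σ → MvPolynomial σ K}
    (hp : ∀ i, Ideal.Quotient.mk J (p i) = f (Ideal.Quotient.mk I (X i)))
    (g : MvPolynomial σ K) :
    Ideal.Quotient.mk J (aeval p g) = f (Ideal.Quotient.mk I g) := by
  have : (Ideal.Quotient.mkₐ K J).comp (aeval p) = f.comp (Ideal.Quotient.mkₐ K I) :=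
    algHom_ext fun i => by simpa using hp i
  exact DFunLike.congr_fun this g

lemma aeval_mem_of_mk_eq {I J : Ideal (MvPolynomial σ K)}
    (f : (MvPolynomial σ K ⧸ I) →ₐ[K] (MvPolynomial σ K ⧸ J)) {p : σ → MvPolynomial σ K}
    (hp : ∀ i, Ideal.Quotient.mk J (p i) = f (Ideal.Quotient.mk I (X i)))
    {g : MvPolynomial σ K} (hg : g ∈ I) : aeval p g ∈ J := by
  rw [← Ideal.Quotient.eq_zero_iff_mem, mk_aeval_of_mk_eq f hp,
    Ideal.Quotient.eq_zero_iff_mem.2 hg, map_zero]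

/-- Passing to the linear part of a substitution preserves the inclusion between homogeneous
ideals. -/
lemma aeval_linear_part_mem [Fintype σ] {I J : Ideal (MvPolynomial σ K)}
    (hI : ∀ f ∈ I, ∀ k, homogeneousComponent k f ∈ I)
    (hJ : ∀ f ∈ J, ∀ k, homogeneousComponent k f ∈ J)
    {p : σ → MvPolynomial σ K} (hp : ∀ i, p i ∈ idealOfVars σ K)
    (hIJ : ∀ g ∈ I, aeval p g ∈ J) {g : MvPolynomial σ K} (hg : g ∈ I) :
    aeval (fun i => linearForm (linearCoeff (p i))) g ∈ J := by
  rw [← sum_homogeneousComponent g, map_sum]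
  refine sum_mem fun k _ => ?_
  have hk := homogeneousComponent_isHomogeneous k g
  have hlin : (aeval (fun i => linearForm (linearCoeff (p i)))
      (homogeneousComponent k g)).IsHomogeneous k := by
    simpa using hk.aeval (n := 1) _ fun i => linearForm_isHomogeneous (linearCoeff (p i))
  have h := homogeneousComponent_eq_zero_of_mem_pow (aeval_sub_aeval_mem_of_isHomogeneous hp
    (fun i => linearForm_mem_idealOfVars _) (fun i => sub_linearForm_linearCoeff_mem (hp i)) hk)
    k.lt_succ_self
  rw [map_sub, homogeneousComponent_eq_self hlin, sub_eq_zero] at h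
  rw [← h]
  exact hJ _ (hIJ _ (hI _ hg k)) k

/-- An automorphism mapping an ideal into another one of the same finite codimension maps it onto
the latter. -/
lemma map_eq_of_finrank_eq {I J : Ideal (MvPolynomial σ K)}
    [FiniteDimensional K (MvPolynomial σ K ⧸ I)] [FiniteDimensional K (MvPolynomial σ K ⧸ J)]
    (hrank : Module.finrank K (MvPolynomial σ K ⧸ I) = Module.finrank K (MvPolynomial σ K ⧸ J))
    (φ : MvPolynomial σ K ≃ₐ[K] MvPolynomial σ K) (hφ : ∀ g ∈ I, φ g ∈ J) :
    Ideal.map φ I = J := by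
  let ψ := Ideal.quotientMapₐ J (φ : MvPolynomial σ K →ₐ[K] MvPolynomial σ K) hφ
  have hψ : ∀ g, ψ (Ideal.Quotient.mk I g) = Ideal.Quotient.mk J (φ g) := fun g => rfl
  have hsurj : Function.Surjective ψ := by
    intro y
    obtain ⟨y, rfl⟩ := Ideal.Quotient.mk_surjective y
    refine ⟨Ideal.Quotient.mk I (φ.symm y), (hψ _).trans ?_⟩
    rw [φ.apply_symm_apply]
  have hinj : Function.Injective ψ :=
    (LinearMap.injective_iff_surjective_of_finrank_eq_finrank (f := ψ.toLinearMap) hrank).2 hsurj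
  refine le_antisymm (Ideal.map_le_iff_le_comap.2 hφ) fun h hh => ?_
  have : φ.symm h ∈ I := by
    rw [← Ideal.Quotient.eq_zero_iff_mem]
    apply hinj
    rw [hψ, φ.apply_symm_apply, map_zero, Ideal.Quotient.eq_zero_iff_mem.2 hh]
  simpa using Ideal.mem_map_of_mem φ this

/-- Homogeneous ideals of finite codimension with isomorphic quotients are related by a linear
change of variables. -/
lemma exists_linearChange_map_eq [Fintype σ] [DecidableEq σ] {I J : Ideal (MvPolynomial σ K)}
    (hI : ∀ f ∈ I, ∀ k, homogeneousComponent k f ∈ I)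
    (hJ : ∀ f ∈ J, ∀ k, homogeneousComponent k f ∈ J)
    (hIm : I ≤ idealOfVars σ K) (hJm : J ≤ idealOfVars σ K)
    [FiniteDimensional K (MvPolynomial σ K ⧸ I)] [FiniteDimensional K (MvPolynomial σ K ⧸ J)]
    (f : (MvPolynomial σ K ⧸ I) ≃ₐ[K] (MvPolynomial σ K ⧸ J)) :
    ∃ e : (σ → K) ≃ₗ[K] (σ → K), Ideal.map (linearChange e) I = J := by
  choose p hp using fun i => Ideal.Quotient.mk_surjective (f (Ideal.Quotient.mk I (X i)))
  choose q hq using fun i => Ideal.Quotient.mk_surjective (f.symm (Ideal.Quotient.mk J (X i)))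
  have hpm : ∀ i, p i ∈ idealOfVars σ K := fun i => mem_idealOfVars_of_mk_eq hI hJm f.toAlgHom (hp i)
  have hqm : ∀ i, q i ∈ idealOfVars σ K :=
    fun i => mem_idealOfVars_of_mk_eq hJ hIm f.symm.toAlgHom (hq i)
  have hqp : ∀ g, aeval q (aeval p g) - g ∈ I := fun g => by
    rw [← Ideal.Quotient.eq, mk_aeval_of_mk_eq f.symm.toAlgHom hq, mk_aeval_of_mk_eq f.toAlgHom hp]
    exact f.symm_apply_apply _
  have hpq : ∀ g, aeval p (aeval q g) - g ∈ J := fun g => by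
    rw [← Ideal.Quotient.eq, mk_aeval_of_mk_eq f.toAlgHom hp, mk_aeval_of_mk_eq f.symm.toAlgHom hq]
    exact f.apply_symm_apply _
  have hlin : ∀ {r : σ → MvPolynomial σ K}, (∀ i, r i ∈ idealOfVars σ K) → ∀ v : σ → K,
      aeval r (linearForm v) ∈ idealOfVars σ K := fun hr v => by
    simpa using aeval_mem_pow_idealOfVars hr (n := 1) (by simpa using linearForm_mem_idealOfVars v)
  obtain ⟨e, he⟩ := exists_linearEquiv_sub_mem
    ((I.restrictScalars K).comap linearForm) ((J.restrictScalars K).comap linearForm)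
    (linearCoeff ∘ₗ (aeval p).toLinearMap ∘ₗ linearForm)
    (linearCoeff ∘ₗ (aeval q).toLinearMap ∘ₗ linearForm)
    (fun v hv => by
      simpa [linearForm_linearCoeff] using hJ _ (aeval_mem_of_mk_eq f.toAlgHom hp hv) 1)
    (fun v hv => by
      simpa [linearForm_linearCoeff] using hI _ (aeval_mem_of_mk_eq f.symm.toAlgHom hq hv) 1)
    (fun v => by
      have := hI _ (hqp (linearForm v)) 1
      rw [← linearForm_linearCoeff, map_sub, linearCoeff_linearForm] at this
      rw [← linearCoeff_aeval_linearForm_linearCoeff hqm (hlin hpm v)] at this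
      exact this)
    (fun v => by
      have := hJ _ (hpq (linearForm v)) 1
      rw [← linearForm_linearCoeff, map_sub, linearCoeff_linearForm] at this
      rw [← linearCoeff_aeval_linearForm_linearCoeff hpm (hlin hqm v)] at this
      exact this)
  refine ⟨e, map_eq_of_finrank_eq f.toLinearEquiv.finrank_eq _ fun g hg => ?_⟩
  let p' : σ → MvPolynomial σ K := fun i =>
    p i + linearForm (e (Pi.single i 1) - linearCoeff (p i))
  have hp' : ∀ i, Ideal.Quotient.mk J (p' i) = f (Ideal.Quotient.mk I (X i)) := fun i => by
    have := he (Pi.single i 1)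
    simp only [LinearMap.comp_apply, linearForm_single, AlgHom.toLinearMap_apply, aeval_X,
      Submodule.mem_comap, Submodule.restrictScalars_mem] at this
    rw [map_add, hp, Ideal.Quotient.eq_zero_iff_mem.2 this, add_zero]
  have hcoeff : ∀ i, linearCoeff (p' i) = e (Pi.single i 1) := fun i => by
    simp [p', linearCoeff_linearForm, -map_sub]
  have := aeval_linear_part_mem hI hJ (p := p')
    (fun i => add_mem (hpm i) (linearForm_mem_idealOfVars _))
    (fun g hg => aeval_mem_of_mk_eq f.toAlgHom hp' hg) hg
  simpa only [hcoeff, ← linearChange_apply] using this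

end MvPolynomial

/-- If two graded Artinian quotients of `K[x,y]` by homogeneous ideals are
isomorphic as `K`-algebras then the ideals are related by a linear change of
variables. -/
theorem stmt16 (K : Type*) [Field K] (I₁ I₂ : Ideal (Pxy K))
    (h₁ : IsHomog I₁) (h₂ : IsHomog I₂)
    (hle₁ : I₁ ≤ Ideal.span {X 0, X 1}) (hle₂ : I₂ ≤ Ideal.span {X 0, X 1})
    (hfd₁ : FiniteDimensional K (Pxy K ⧸ I₁))
    (hfd₂ : FiniteDimensional K (Pxy K ⧸ I₂))
    (hiso : Nonempty ((Pxy K ⧸ I₁) ≃ₐ[K] (Pxy K ⧸ I₂))) :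
    ∃ φ : Pxy K ≃ₐ[K] Pxy K, IsLinChange φ ∧ Ideal.map φ I₁ = I₂ := by
  have hm : idealOfVars (Fin 2) K = Ideal.span {X 0, X 1} := by
    rw [idealOfVars]
    congr 1
    ext f
    simp [Fin.exists_fin_two, eq_comm]
  obtain ⟨f⟩ := hiso
  obtain ⟨e, he⟩ := exists_linearChange_map_eq h₁ h₂ (hm ▸ hle₁) (hm ▸ hle₂) f
  refine ⟨linearChange e, fun i => ?_, he⟩
  rw [linearChange_apply, aeval_X]
  exact linearForm_isHomogeneous _
end
end
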